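/- Let P : {±1}^k → {0,1} be a k-ary Boolean predicate and let ν be a pairwise-uniform distribution on {±1}^k given by a multiset S ⊆ {±1}^k (i.e., ν(x) = Pr_{s∼S}[s = x] for all x). Suppose E_{x∼ν}[P(x)] = β and β > E_{x∼uniform({±1}^k)}[P(x)]. Then for every constant ε > 0 there exist an integer r with r ≤ C(ε,k)·|S|^3 (for some constant C(ε,k) depending only on ε and k) and a rational ε̃ with 0 ≤ ε̃ ≤ ε, such that there is a pairwise-uniform distribution θ on {±1}^{r×k} with the property that every matrix in the support of θ has exactly (β − ε̃)·r rows that satisfy P. -/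

import Mathlib

open Finset

/-- A distribution `μ` on `ι → Bool` is `j`-wise uniform: its marginal on every set of at most
`j` coordinates is uniform. -/
def kwiseUniform {ι : Type} [Fintype ι] [DecidableEq ι] (j : ℕ) (μ : (ι → Bool) → ℝ) : Prop :=
  ∀ A : Finset ι, A.card ≤ j → ∀ a : ι → Bool,
    ∑ x ∈ Finset.univ.filter (fun x : ι → Bool => ∀ i ∈ A, x i = a i), μ x
      = (1 / 2 : ℝ) ^ A.card

/-- `μ` is a probability distribution on the finite type `α`. -/
def IsDist {α : Type} [Fintype α] (μ : α → ℝ) : Prop :=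
  (∀ x, 0 ≤ μ x) ∧ ∑ x, μ x = 1

/-- The `±1` value of a bit. -/
def signVal (b : Bool) : ℝ := if b then 1 else -1

lemma signVal_mul_self (b : Bool) : signVal b * signVal b = 1 := by
  cases b <;> simp [signVal]

lemma signVal_not (b : Bool) : signVal (!b) = -signVal b := by
  cases b <;> simp [signVal]

section Characters

variable {ι : Type} [Fintype ι] [DecidableEq ι]

lemma kwiseUniform_two_of_moments {μ : (ι → Bool) → ℝ} (h₀ : ∑ x, μ x = 1)
    (h₁ : ∀ i, ∑ x, μ x * signVal (x i) = 0)
    (h₂ : ∀ i j, i ≠ j → ∑ x, μ x * (signVal (x i) * signVal (x j)) = 0) :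
    kwiseUniform 2 μ := by
  intro A hA a
  rw [Finset.sum_filter]
  have hcases : A.card = 0 ∨ A.card = 1 ∨ A.card = 2 := by omega
  rcases hcases with h | h | h
  · rw [Finset.card_eq_zero] at h
    subst h
    simpa using h₀
  · obtain ⟨i, rfl⟩ := Finset.card_eq_one.1 h
    have hpoint : ∀ x : ι → Bool, (if ∀ l ∈ ({i} : Finset ι), x l = a l then μ x else 0)
        = 1 / 2 * μ x + signVal (a i) / 2 * (μ x * signVal (x i)) := by
      intro x
      simp only [Finset.mem_singleton, forall_eq]
      cases x i <;> cases a i <;> simp [signVal] <;> ring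
    rw [Finset.sum_congr rfl fun x _ => hpoint x, Finset.sum_add_distrib, ← Finset.mul_sum,
      ← Finset.mul_sum, h₀, h₁]
    simp
  · obtain ⟨i, j, hij, rfl⟩ := Finset.card_eq_two.1 h
    have hpoint : ∀ x : ι → Bool, (if ∀ l ∈ ({i, j} : Finset ι), x l = a l then μ x else 0)
        = 1 / 4 * μ x + signVal (a i) / 4 * (μ x * signVal (x i))
          + signVal (a j) / 4 * (μ x * signVal (x j))
          + signVal (a i) * signVal (a j) / 4 * (μ x * (signVal (x i) * signVal (x j))) := by
      intro x
      simp only [Finset.mem_insert, Finset.mem_singleton, forall_eq_or_imp, forall_eq]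
      cases x i <;> cases a i <;> cases x j <;> cases a j <;> simp [signVal] <;> ring
    rw [Finset.sum_congr rfl fun x _ => hpoint x, Finset.sum_add_distrib, Finset.sum_add_distrib,
      Finset.sum_add_distrib, ← Finset.mul_sum, ← Finset.mul_sum, ← Finset.mul_sum,
      ← Finset.mul_sum, h₀, h₁, h₁, h₂ i j hij, h]
    norm_num

lemma kwiseUniform.first_moment {μ : (ι → Bool) → ℝ} (h : kwiseUniform 2 μ) (i : ι) :
    ∑ x, μ x * signVal (x i) = 0 := by
  have hb : ∀ b : Bool, ∑ x, (if x i = b then μ x else 0) = 1 / 2 := by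
    intro b
    have := h {i} (by simp) fun _ => b
    simpa [Finset.sum_filter] using this
  have hpoint : ∀ x : ι → Bool, μ x * signVal (x i)
      = (if x i = true then μ x else 0) - (if x i = false then μ x else 0) := by
    intro x
    cases x i <;> simp [signVal]
  rw [Finset.sum_congr rfl fun x _ => hpoint x, Finset.sum_sub_distrib, hb, hb, sub_self]

lemma kwiseUniform.second_moment {μ : (ι → Bool) → ℝ} (h : kwiseUniform 2 μ) {i j : ι}
    (hij : i ≠ j) : ∑ x, μ x * (signVal (x i) * signVal (x j)) = 0 := by
  have hb : ∀ b c : Bool, ∑ x, (if x i = b ∧ x j = c then μ x else 0) = (1 / 2) ^ 2 := by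
    intro b c
    have := h {i, j} (Finset.card_pair hij).le fun l => if l = i then b else c
    rw [Finset.card_pair hij, Finset.sum_filter] at this
    simpa [hij.symm] using this
  have hpoint : ∀ x : ι → Bool, μ x * (signVal (x i) * signVal (x j))
      = (if x i = true ∧ x j = true then μ x else 0)
        + (if x i = false ∧ x j = false then μ x else 0)
        - (if x i = true ∧ x j = false then μ x else 0)
        - (if x i = false ∧ x j = true then μ x else 0) := by
    intro x
    cases x i <;> cases x j <;> simp [signVal]
  rw [Finset.sum_congr rfl fun x _ => hpoint x, Finset.sum_sub_distrib, Finset.sum_sub_distrib,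
    Finset.sum_add_distrib, hb, hb, hb, hb]
  ring

/-- A function which is odd under flipping coordinate `i` sums to zero over the cube. -/
lemma sum_signVal_mul_eq_zero (i : ι) (g : (ι → Bool) → ℝ)
    (hg : ∀ x, g (Function.update x i (!x i)) = g x) :
    ∑ x : ι → Bool, signVal (x i) * g x = 0 := by
  have hinv : Function.Involutive fun x : ι → Bool => Function.update x i (!x i) := by
    intro x
    simp
  have h := Equiv.sum_comp hinv.toPerm fun x : ι → Bool => signVal (x i) * g x
  simp only [Function.Involutive.coe_toPerm, Function.update_self, hg, signVal_not, neg_mul,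
    Finset.sum_neg_distrib] at h
  linarith

lemma sum_signVal (i : ι) : ∑ x : ι → Bool, signVal (x i) = 0 := by
  simpa using sum_signVal_mul_eq_zero i (fun _ => 1) fun _ => rfl

lemma sum_signVal_mul_signVal {i j : ι} (hij : i ≠ j) :
    ∑ x : ι → Bool, signVal (x i) * signVal (x j) = 0 :=
  sum_signVal_mul_eq_zero i (fun x => signVal (x j)) fun x => by simp [hij.symm]

end Characters

lemma sum_count_div_card_mul {α : Type} [Fintype α] [DecidableEq α] (S : Multiset α)
    (g : α → ℝ) :
    ∑ x, (S.count x : ℝ) / (Multiset.card S : ℝ) * g x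
      = (S.map g).sum / (Multiset.card S : ℝ) := by
  rw [Finset.sum_multiset_map_count, Finset.sum_div]
  symm
  refine (Finset.sum_subset (Finset.subset_univ _) fun x _ hx => ?_).trans
    (Finset.sum_congr rfl fun x _ => ?_)
  · rw [Multiset.mem_toFinset] at hx
    simp [Multiset.count_eq_zero_of_notMem hx]
  · rw [nsmul_eq_mul]
    ring

lemma Multiset.exists_fin_map_eq {α : Type} (R : Multiset α) {r : ℕ} (hr : Multiset.card R = r) :
    ∃ X : Fin r → α, (Finset.univ : Finset (Fin r)).val.map X = R := by
  subst hr
  induction R using Quotient.inductionOn with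
  | h l =>
    refine ⟨l.get, ?_⟩
    change ((List.finRange l.length : Multiset (Fin l.length)).map l.get) = (l : Multiset α)
    rw [Multiset.map_coe, List.map_get_finRange]

lemma exists_perm_apply_eq_pair {α : Type} [DecidableEq α] {l₁ l₂ m₁ m₂ : α} (hl : l₁ ≠ l₂) (hm : m₁ ≠ m₂) :
    ∃ τ : Equiv.Perm α, τ l₁ = m₁ ∧ τ l₂ = m₂ := by
  refine ⟨Equiv.swap (Equiv.swap l₁ m₁ l₂) m₂ * Equiv.swap l₁ m₁, ?_, by simp⟩
  have h : Equiv.swap l₁ m₁ l₂ ≠ m₁ := by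
    intro h
    exact hl ((Equiv.swap l₁ m₁).injective (by rw [h, Equiv.swap_apply_left]))
  simp [Equiv.swap_apply_of_ne_of_ne h.symm hm]

section Permutations

variable {α : Type} [Fintype α] [DecidableEq α]

lemma card_mul_sum_perm (f : α → ℝ) (l : α) :
    (Fintype.card α : ℝ) * ∑ σ : Equiv.Perm α, f (σ l)
      = (Fintype.card (Equiv.Perm α) : ℝ) * ∑ a, f a := by
  have hconst : ∀ l' : α, ∑ σ : Equiv.Perm α, f (σ l') = ∑ σ : Equiv.Perm α, f (σ l) := by
    intro l'
    rw [← Equiv.sum_comp (Equiv.mulRight (Equiv.swap l l'))]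
    simp
  have hsum : ∑ l' : α, ∑ σ : Equiv.Perm α, f (σ l')
      = (Fintype.card α : ℝ) * ∑ σ : Equiv.Perm α, f (σ l) := by
    rw [Finset.sum_congr rfl fun l' _ => hconst l']
    simp
  rw [← hsum, Finset.sum_comm, Finset.sum_congr rfl fun σ _ => Equiv.sum_comp σ f]
  simp

lemma card_mul_sum_perm_pair (f : α → α → ℝ) {l₁ l₂ : α} (hl : l₁ ≠ l₂) :
    (((Finset.univ : Finset α).offDiag.card : ℕ) : ℝ) * ∑ σ : Equiv.Perm α, f (σ l₁) (σ l₂)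
      = (Fintype.card (Equiv.Perm α) : ℝ) *
        ∑ p ∈ (Finset.univ : Finset α).offDiag, f p.1 p.2 := by
  have hconst : ∀ p ∈ (Finset.univ : Finset α).offDiag,
      ∑ σ : Equiv.Perm α, f (σ p.1) (σ p.2) = ∑ σ : Equiv.Perm α, f (σ l₁) (σ l₂) := by
    intro p hp
    obtain ⟨τ, h₁, h₂⟩ := exists_perm_apply_eq_pair (Finset.mem_offDiag.1 hp).2.2 hl
    rw [← h₁, ← h₂, ← Equiv.sum_comp (Equiv.mulRight τ)]
    simp
  have hsum : ∑ p ∈ (Finset.univ : Finset α).offDiag, ∑ σ : Equiv.Perm α, f (σ p.1) (σ p.2)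
      = (((Finset.univ : Finset α).offDiag.card : ℕ) : ℝ)
        * ∑ σ : Equiv.Perm α, f (σ l₁) (σ l₂) := by
    rw [Finset.sum_congr rfl hconst]
    simp
  have hperm : ∀ σ : Equiv.Perm α, ∑ p ∈ (Finset.univ : Finset α).offDiag, f (σ p.1) (σ p.2)
      = ∑ p ∈ (Finset.univ : Finset α).offDiag, f p.1 p.2 := by
    intro σ
    refine Finset.sum_equiv (Equiv.prodCongr σ σ) (fun p => ?_) fun p _ => rfl
    simp [Finset.mem_offDiag]
  rw [← hsum, Finset.sum_comm, Finset.sum_congr rfl fun σ _ => hperm σ]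
  simp

lemma sum_offDiag_mul (f g : α → ℝ) :
    ∑ p ∈ (Finset.univ : Finset α).offDiag, f p.1 * g p.2
      = (∑ a, f a) * (∑ a, g a) - ∑ a, f a * g a := by
  rw [Finset.sum_mul_sum, ← Finset.sum_product', ← Finset.diag_union_offDiag,
    Finset.sum_union (Finset.disjoint_diag_offDiag _), Finset.sum_diag]
  ring

end Permutations

lemma Multiset.sum_map_fin {α : Type} {r : ℕ} {X : Fin r → α} {R : Multiset α}
    (h : (Finset.univ : Finset (Fin r)).val.map X = R) (g : α → ℝ) :
    ∑ l, g (X l) = (R.map g).sum := by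
  rw [← h, Multiset.map_map]
  rfl

/-- Draw a multiset of `r` rows at random and put its elements into the rows of a matrix in
uniformly random order. If the moments of the column sums are those of a uniform matrix, the
result is pairwise uniform. -/
lemma exists_pairwise_uniform_of_row_multisets {k r c : ℕ} (hr : 0 < r)
    (P : (Fin k → Bool) → Bool) {Ω : Type} [Fintype Ω] (w : Ω → ℝ) (hw : ∀ ω, 0 ≤ w ω)
    (hw₁ : ∑ ω, w ω = 1) (R : Ω → Multiset (Fin k → Bool))
    (hcard : ∀ ω, Multiset.card (R ω) = r)
    (hP : ∀ ω, Multiset.card ((R ω).filter fun x => P x = true) = c)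
    (h₁ : ∀ i, ∑ ω, w ω * ((R ω).map fun x => signVal (x i)).sum = 0)
    (h₂ : ∀ i j, i ≠ j → ∑ ω, w ω * ((R ω).map fun x => signVal (x i) * signVal (x j)).sum = 0)
    (h₃ : ∀ i j, ∑ ω, w ω * (((R ω).map fun x => signVal (x i)).sum
      * ((R ω).map fun x => signVal (x j)).sum) = if i = j then (r : ℝ) else 0) :
    ∃ θ : (Fin r × Fin k → Bool) → ℝ, IsDist θ ∧ kwiseUniform 2 θ ∧
      ∀ M : Fin r × Fin k → Bool, θ M ≠ 0 →
        (Finset.univ.filter fun l : Fin r => P (fun i => M (l, i)) = true).card = c := by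
  classical
  choose X hX using fun ω => Multiset.exists_fin_map_eq (R ω) (hcard ω)
  let N : ℝ := Fintype.card (Equiv.Perm (Fin r))
  have hN : 0 < N := Nat.cast_pos.2 Fintype.card_pos
  let F : Ω × Equiv.Perm (Fin r) → Fin r × Fin k → Bool := fun p q => X p.1 (p.2 q.1) q.2
  let θ : (Fin r × Fin k → Bool) → ℝ := fun M => ∑ p, if F p = M then w p.1 / N else 0
  have hθ : ∀ g : (Fin r × Fin k → Bool) → ℝ,
      ∑ M, θ M * g M = (∑ ω, w ω * ∑ σ : Equiv.Perm (Fin r), g (F (ω, σ))) / N := by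
    intro g
    simp only [θ, Finset.sum_mul]
    rw [Finset.sum_comm, Finset.sum_div, Fintype.sum_prod_type]
    refine Finset.sum_congr rfl fun ω _ => ?_
    rw [Finset.mul_sum, Finset.sum_div]
    refine Finset.sum_congr rfl fun σ _ => ?_
    simp only [ite_mul, zero_mul, Finset.sum_ite_eq, Finset.mem_univ, if_true]
    ring
  have htotal : ∑ M, θ M = 1 := by
    have := hθ fun _ => 1
    simp only [mul_one, Finset.sum_const, Finset.card_univ, nsmul_eq_mul] at this
    rw [this, ← Finset.sum_mul, hw₁, one_mul]
    exact div_self hN.ne'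
  have hrow : ∀ (l : Fin r) (f : (Fin k → Bool) → ℝ), (∑ ω, w ω * ((R ω).map f).sum = 0) →
      ∑ ω, w ω * ∑ σ : Equiv.Perm (Fin r), f (X ω (σ l)) = 0 := by
    intro l f hf
    have hr' : (r : ℝ) ≠ 0 := by positivity
    refine (mul_eq_zero.1 ?_).resolve_left hr'
    calc (r : ℝ) * ∑ ω, w ω * ∑ σ : Equiv.Perm (Fin r), f (X ω (σ l))
        = ∑ ω, N * (w ω * ((R ω).map f).sum) := by
          rw [Finset.mul_sum]
          refine Finset.sum_congr rfl fun ω _ => ?_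
          have := card_mul_sum_perm (fun a => f (X ω a)) l
          rw [Fintype.card_fin, Multiset.sum_map_fin (hX ω)] at this
          linear_combination w ω * this
      _ = 0 := by rw [← Finset.mul_sum, hf, mul_zero]
  refine ⟨θ, ⟨fun M => ?_, htotal⟩, kwiseUniform_two_of_moments htotal ?_ ?_, ?_⟩
  · refine Finset.sum_nonneg fun p _ => ?_
    split_ifs
    · exact div_nonneg (hw _) hN.le
    · exact le_rfl
  · rintro ⟨l, i⟩
    rw [hθ fun M => signVal (M (l, i)), hrow l (fun x => signVal (x i)) (h₁ i), zero_div]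
  · rintro ⟨l₁, i⟩ ⟨l₂, j⟩ hne
    rw [hθ fun M => signVal (M (l₁, i)) * signVal (M (l₂, j))]
    by_cases hl : l₁ = l₂
    · subst hl
      have hij : i ≠ j := fun h => hne (by rw [h])
      rw [hrow l₁ (fun x => signVal (x i) * signVal (x j)) (h₂ i j hij), zero_div]
    · have hD : (((Finset.univ : Finset (Fin r)).offDiag.card : ℕ) : ℝ) ≠ 0 := by
        rw [Nat.cast_ne_zero, Finset.card_ne_zero]
        exact ⟨(l₁, l₂), by simp [hl]⟩
      have hdiag : ∑ ω, w ω * ((R ω).map fun x => signVal (x i) * signVal (x j)).sum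
          = if i = j then (r : ℝ) else 0 := by
        split_ifs with hij
        · subst hij
          simp only [signVal_mul_self, Multiset.map_const', Multiset.sum_replicate, hcard,
            nsmul_eq_mul, mul_one]
          rw [← Finset.sum_mul, hw₁, one_mul]
        · exact h₂ i j hij
      rw [div_eq_zero_iff]
      left
      refine (mul_eq_zero.1 ?_).resolve_left hD
      calc (((Finset.univ : Finset (Fin r)).offDiag.card : ℕ) : ℝ)
            * ∑ ω, w ω * ∑ σ : Equiv.Perm (Fin r),
              signVal (F (ω, σ) (l₁, i)) * signVal (F (ω, σ) (l₂, j))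
          = ∑ ω, N * (w ω * (((R ω).map fun x => signVal (x i)).sum
              * ((R ω).map fun x => signVal (x j)).sum)
              - w ω * ((R ω).map fun x => signVal (x i) * signVal (x j)).sum) := by
            rw [Finset.mul_sum]
            refine Finset.sum_congr rfl fun ω _ => ?_
            have := card_mul_sum_perm_pair
              (fun a b => signVal (X ω a i) * signVal (X ω b j)) hl
            rw [sum_offDiag_mul (fun a => signVal (X ω a i)) fun a => signVal (X ω a j),
              Multiset.sum_map_fin (hX ω) fun x => signVal (x i),
              Multiset.sum_map_fin (hX ω) fun x => signVal (x j),
              Multiset.sum_map_fin (hX ω) fun x => signVal (x i) * signVal (x j)] at this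
            linear_combination w ω * this
        _ = 0 := by rw [← Finset.mul_sum, Finset.sum_sub_distrib, h₃, hdiag, sub_self, mul_zero]
  · intro M hM
    obtain ⟨⟨ω, σ⟩, -, hp⟩ := Finset.exists_ne_zero_of_sum_ne_zero hM
    have hF : F (ω, σ) = M := by
      by_contra h
      exact hp (if_neg h)
    subst hF
    rw [← hP ω, ← hX ω, Multiset.filter_map, Multiset.card_map]
    change _ = (Finset.univ.filter fun l : Fin r => P (X ω l) = true).card
    refine Finset.card_equiv σ fun l => ?_
    simp [F]

/-- `e` copies of `z`, `v` copies of `S` and `u` copies of the whole cube. -/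
def rowMultiset {k : ℕ} (S : Multiset (Fin k → Bool)) (e v u : ℕ) (z : Fin k → Bool) :
    Multiset (Fin k → Bool) :=
  Multiset.replicate e z + v • S + u • (Finset.univ : Finset (Fin k → Bool)).val

lemma card_rowMultiset {k : ℕ} (S : Multiset (Fin k → Bool)) (e v u : ℕ) (z : Fin k → Bool) :
    Multiset.card (rowMultiset S e v u z) = e + v * Multiset.card S + u * 2 ^ k := by
  simp [rowMultiset]

lemma card_filter_rowMultiset {k : ℕ} (P : (Fin k → Bool) → Bool) (S : Multiset (Fin k → Bool))
    (e v u : ℕ) (z : Fin k → Bool) :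
    Multiset.card ((rowMultiset S e v u z).filter fun x => P x = true)
      = (if P z = true then e else 0) + v * Multiset.card (S.filter fun x => P x = true)
        + u * (Finset.univ.filter fun x : Fin k → Bool => P x = true).card := by
  simp only [rowMultiset, Multiset.filter_add, Multiset.card_add, Multiset.filter_nsmul,
    Multiset.card_nsmul, ← Finset.filter_val, Finset.card_val]
  congr 2
  split_ifs with h
  · rw [Multiset.filter_eq_self.2 fun x hx => Multiset.eq_of_mem_replicate hx ▸ h]
    simp
  · rw [Multiset.filter_eq_nil.2 fun x hx => Multiset.eq_of_mem_replicate hx ▸ h]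
    simp

lemma sum_map_rowMultiset {k : ℕ} (S : Multiset (Fin k → Bool)) (e v u : ℕ)
    (z : Fin k → Bool) (g : (Fin k → Bool) → ℝ) (hS : (S.map g).sum = 0) (hg : ∑ x, g x = 0) :
    ((rowMultiset S e v u z).map g).sum = e * g z := by
  have hg' : ((Finset.univ : Finset (Fin k → Bool)).val.map g).sum = 0 := hg
  simp [rowMultiset, Multiset.map_nsmul, Multiset.sum_nsmul, hS, hg']

/-- a pairwise-uniform distribution with E[P] = β (given by a multiset S) can be
turned into a pairwise-uniform distribution on r×k matrices every outcome of which satisfies P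
in exactly (β - ε̃)·r of its r rows. -/
theorem stmt6 (k : ℕ) :
    ∀ ε : ℝ, 0 < ε →
      ∃ C : ℝ, 0 < C ∧
        ∀ (P : (Fin k → Bool) → Bool) (S : Multiset (Fin k → Bool)) (β : ℝ),
          S ≠ 0 →
          -- ν(x) = Pr_{s∼S}[s = x] is pairwise uniform
          kwiseUniform 2 (fun x : Fin k → Bool => (S.count x : ℝ) / (Multiset.card S : ℝ)) →
          -- E_{x∼ν}[P(x)] = β
          ((Multiset.card (S.filter fun x => P x = true) : ℝ) / (Multiset.card S : ℝ) = β) →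
          -- β exceeds the expectation of P under the uniform distribution
          ((Finset.univ.filter fun x : Fin k → Bool => P x = true).card : ℝ) / 2 ^ k < β →
          ∃ (r : ℕ) (εt : ℚ),
            0 < r ∧ (r : ℝ) ≤ C * (Multiset.card S : ℝ) ^ 3 ∧
            0 ≤ (εt : ℝ) ∧ (εt : ℝ) ≤ ε ∧
            ∃ θ : (Fin r × Fin k → Bool) → ℝ,
              IsDist θ ∧ kwiseUniform 2 θ ∧
              ∀ M : Fin r × Fin k → Bool, θ M ≠ 0 →
                ((Finset.univ.filter fun l : Fin r =>
                    P (fun i => M (l, i)) = true).card : ℝ) = (β - (εt : ℝ)) * r := by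
  intro ε hε
  obtain ⟨L, hL⟩ := exists_nat_gt (1 / ε)
  have hLpos : 0 < (L : ℝ) := lt_trans (by positivity) hL
  have hL1 : 1 ≤ L := by exact_mod_cast hLpos
  set q : ℕ := 2 ^ (k + 1) * L with hq
  have hqpos : 0 < q := by positivity
  have hqk : 2 * 2 ^ k ≤ q := by
    rw [hq, pow_succ']
    exact Nat.le_mul_of_pos_right _ hL1
  refine ⟨(q : ℝ) ^ 2, by positivity, ?_⟩
  intro P S β hS hν hβ hlt
  set m := Multiset.card S with hm
  set a := Multiset.card (S.filter fun x => P x = true) with ha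
  set b := (Finset.univ.filter fun x : Fin k → Bool => P x = true).card with hb
  have hmpos : 0 < m := Multiset.card_pos.2 hS
  have hmR : (0 : ℝ) < m := by exact_mod_cast hmpos
  have ham : a ≤ m := Multiset.card_le_card (Multiset.filter_le _ _)
  have hgap : b * m < a * 2 ^ k := by
    rw [← hβ, div_lt_div_iff₀ (by positivity) hmR] at hlt
    exact_mod_cast hlt
  obtain ⟨d, hd⟩ := Nat.exists_eq_add_of_lt hgap
  set D := d + 1 with hD
  have habD : a * 2 ^ k = b * m + D := by omega
  have hDm : D ≤ m * 2 ^ k := by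
    have := Nat.mul_le_mul_right (2 ^ k) ham
    omega
  have hDR : (0 : ℝ) < D := by positivity
  have hS₁ : ∀ i, (S.map fun x => signVal (x i)).sum = 0 := by
    intro i
    have := hν.first_moment i
    rw [sum_count_div_card_mul S fun x => signVal (x i)] at this
    exact (div_eq_zero_iff.1 this).resolve_right hmR.ne'
  have hS₂ : ∀ i j, i ≠ j → (S.map fun x => signVal (x i) * signVal (x j)).sum = 0 := by
    intro i j hij
    have := hν.second_moment hij
    rw [sum_count_div_card_mul S fun x => signVal (x i) * signVal (x j)] at this
    exact (div_eq_zero_iff.1 this).resolve_right hmR.ne'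
  -- numbers of copies of `S` in the three kinds of row multisets
  have hmq : 2 * 2 ^ k * (m * q) ≤ q * (m * q) := Nat.mul_le_mul_right _ hqk
  have hDq : D * q ≤ m * 2 ^ k * q := Nat.mul_le_mul_right _ hDm
  have haq : a * (q * 2 ^ k) ≤ m * (q * 2 ^ k) := Nat.mul_le_mul_right _ ham
  obtain ⟨vA, hvA⟩ : ∃ v, m * q ^ 2 = v + a * q * 2 ^ k :=
    Nat.exists_eq_add_of_le' (by nlinarith)
  obtain ⟨v₀, hv₀⟩ : ∃ v, m * q ^ 2 = v + D * q := Nat.exists_eq_add_of_le' (by nlinarith)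
  obtain ⟨v₁, hv₁⟩ : ∃ v, m * q ^ 2 = v + (D * q + q * m * 2 ^ k) :=
    Nat.exists_eq_add_of_le' (by nlinarith)
  let e : Bool → ℕ := fun s => if s then D * m * q else 0
  let v : Bool × (Fin k → Bool) → ℕ := fun ω => if ω.1 then (if P ω.2 then v₁ else v₀) else vA
  let u : Bool × (Fin k → Bool) → ℕ := fun ω =>
    if ω.1 then (if P ω.2 then q * m ^ 2 else 0) else a * q * m
  let w : Bool × (Fin k → Bool) → ℝ := fun ω =>
    (if ω.1 then 1 / (D : ℝ) ^ 2 else 1 - 1 / (D : ℝ) ^ 2) / 2 ^ k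
  have hmoment : ∀ g : (Fin k → Bool) → ℝ, ∀ f : ℕ → ℝ,
      ∑ ω, w ω * (f (e ω.1) * g ω.2)
        = (1 / (D : ℝ) ^ 2 * f (D * m * q) + (1 - 1 / (D : ℝ) ^ 2) * f 0) / 2 ^ k
          * ∑ z, g z := by
    intro g f
    rw [Fintype.sum_prod_type, Fintype.sum_bool, Finset.mul_sum, ← Finset.sum_add_distrib]
    refine Finset.sum_congr rfl fun z _ => ?_
    simp only [w, e, if_true, Bool.false_eq_true, if_false]
    ring
  have hmain := exists_pairwise_uniform_of_row_multisets (k := k)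
    (r := m ^ 2 * q ^ 2) (c := a * v₀) (by positivity) P w ?_ ?_
    (fun ω => rowMultiset S (e ω.1) (v ω) (u ω) ω.2) ?_ ?_ ?_ ?_ ?_
  · obtain ⟨θ, hθ, hθ₂, hθP⟩ := hmain
    refine ⟨m ^ 2 * q ^ 2, (a * D : ℚ) / (m ^ 2 * q), by positivity, ?_, by positivity, ?_,
      θ, hθ, hθ₂, fun M hM => ?_⟩
    · have hm1 : (1 : ℝ) ≤ m := by exact_mod_cast hmpos
      push_cast
      have : (m : ℝ) ^ 2 ≤ (m : ℝ) ^ 3 := pow_le_pow_right₀ hm1 (by norm_num)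
      nlinarith [sq_nonneg (q : ℝ)]
    · push_cast
      have haR : (a : ℝ) ≤ m := by exact_mod_cast ham
      have hDR' : (D : ℝ) ≤ m * 2 ^ k := by exact_mod_cast hDm
      have hεL : 1 ≤ ε * L := by
        rw [div_lt_iff₀ hε] at hL
        linarith
      have hqR : (q : ℝ) = 2 * 2 ^ k * L := by
        rw [hq]
        push_cast
        ring
      rw [div_le_iff₀ (by positivity)]
      calc (a : ℝ) * D ≤ m * (m * 2 ^ k) := by gcongr
        _ = (m ^ 2 * 2 ^ k) * 1 := by ring
        _ ≤ (m ^ 2 * 2 ^ k) * (2 * (ε * L)) := by gcongr; linarith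
        _ = ε * (m ^ 2 * q) := by rw [hqR]; ring
    · rw [hθP M hM, ← hβ]
      have hv₀R : (m : ℝ) * q ^ 2 = v₀ + D * q := by exact_mod_cast hv₀
      have hqR : (0 : ℝ) < q := by exact_mod_cast hqpos
      push_cast
      field_simp
      linear_combination (-(a : ℝ)) * hv₀R
  · rintro ⟨s, z⟩
    have hD1 : 1 / (D : ℝ) ^ 2 ≤ 1 := by
      rw [div_le_one (by positivity)]
      exact one_le_pow₀ (by exact_mod_cast Nat.succ_le_succ (Nat.zero_le d))
    refine div_nonneg ?_ (by positivity)
    dsimp only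
    split_ifs
    · positivity
    · linarith
  · have := hmoment (fun _ => 1) fun _ => 1
    simp only [mul_one] at this
    rw [this]
    simp
  · rintro ⟨s, z⟩
    rw [card_rowMultiset, ← hm]
    zify at hvA hv₀ hv₁ ⊢
    cases s
    · simp only [e, v, u, Bool.false_eq_true, if_false]
      push_cast
      linear_combination (-m : ℤ) * hvA
    · cases hPz : P z
      · simp only [e, v, u, hPz, Bool.false_eq_true, if_true, if_false]
        push_cast
        linear_combination (-m : ℤ) * hv₀
      · simp only [e, v, u, hPz, if_true]
        push_cast
        linear_combination (-m : ℤ) * hv₁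
  · rintro ⟨s, z⟩
    rw [card_filter_rowMultiset, ← ha, ← hb]
    zify at hvA hv₀ hv₁ habD ⊢
    cases s
    · simp only [e, v, u, Bool.false_eq_true, if_false]
      push_cast
      rw [ite_self]
      linear_combination (a : ℤ) * (hv₀ - hvA) - (a * q : ℤ) * habD
    · cases hPz : P z
      · simp only [e, v, u, hPz, Bool.false_eq_true, if_true, if_false]
        push_cast
        ring
      · simp only [e, v, u, hPz, if_true]
        push_cast
        linear_combination (a : ℤ) * (hv₀ - hv₁) - (q * m : ℤ) * habD
  · intro i
    simp only [sum_map_rowMultiset _ _ _ _ _ (fun x => signVal (x i)) (hS₁ i) (sum_signVal i)]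
    rw [hmoment (fun z => signVal (z i)) fun n => n, sum_signVal, mul_zero]
  · intro i j hij
    simp only [sum_map_rowMultiset _ _ _ _ _ (fun x => signVal (x i) * signVal (x j))
      (hS₂ i j hij) (sum_signVal_mul_signVal hij)]
    rw [hmoment (fun z => signVal (z i) * signVal (z j)) fun n => n,
      sum_signVal_mul_signVal hij, mul_zero]
  · intro i j
    simp only [sum_map_rowMultiset _ _ _ _ _ (fun x => signVal (x i)) (hS₁ i) (sum_signVal i),
      sum_map_rowMultiset _ _ _ _ _ (fun x => signVal (x j)) (hS₁ j) (sum_signVal j)]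
    have := hmoment (fun z => signVal (z i) * signVal (z j)) fun n => (n : ℝ) ^ 2
    rw [Finset.sum_congr rfl fun ω _ => show _ = w ω * ((e ω.1 : ℝ) ^ 2 *
      (signVal (ω.2 i) * signVal (ω.2 j))) by ring, this]
    split_ifs with hij
    · subst hij
      simp only [signVal_mul_self]
      simp
      field_simp
    · rw [sum_signVal_mul_signVal hij, mul_zero]
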